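/- Let (Ω, Σ, P) be a probability space, let R be a short linear order equipped with a σ-algebra containing all initial segments (-∞, r], and let f : Ω → R be measurable with atomless pushforward measure P∘f⁻¹. Define f̂(x) = P{y : f(y) ≤ f(x)}. Then f̂ is an exact p-function: P{x : f̂(x) ≤ ε} = ε for every ε ∈ [0,1]. -/

import Mathlib

open MeasureTheory

/-- The set of countable ordinals (the first uncountable ordinal ω₁), with its natural order. -/
abbrev Omega1 : Type 1 := {o : Ordinal // o.card ≤ Cardinal.aleph0}

/-- An atom of a measure: a measurable set of positive measure that cannot be split into
two disjoint measurable sets of positive measure. -/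
def IsMeasureAtom {α : Type*} [MeasurableSpace α] (P : Measure α) (A : Set α) : Prop :=
  MeasurableSet A ∧ 0 < P A ∧
    ¬ ∃ B C : Set α, MeasurableSet B ∧ MeasurableSet C ∧ Disjoint B C ∧ B ∪ C = A ∧
      0 < P B ∧ 0 < P C

theorem Omega1.countable_Iio (o : Omega1) : (Set.Iio o).Countable := by
  have h : (Set.Iio o.1).Countable := by
    rw [← Cardinal.le_aleph0_iff_set_countable, Cardinal.mk_Iio_ordinal]
    exact Cardinal.lift_le_aleph0.2 o.2
  exact h.preimage Subtype.val_injective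

/-- In a linear order into which `ω₁` does not embed, every set has a countable cofinal subset. -/
theorem exists_countable_cofinal {R : Type*} [LinearOrder R] (hR : ¬ Nonempty (Omega1 ↪o R))
    (S : Set R) : ∃ C ⊆ S, C.Countable ∧ ∀ s ∈ S, ∃ c ∈ C, s ≤ c := by
  by_contra! h
  refine hR ?_
  have h' : ∀ C : Set S, C.Countable → ∃ s : S, ∀ c ∈ C, c < s := fun C hC ↦ by
    obtain ⟨s, hs, hlt⟩ := h (Subtype.val '' C) (by simp) (hC.image _)
    exact ⟨⟨s, hs⟩, fun c hc ↦ hlt c ⟨c, hc, rfl⟩⟩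
  choose next hnext using h'
  have hcount : ∀ (o : Omega1) (g : ∀ p, p < o → S),
      (Set.range fun p : Set.Iio o ↦ g p p.2).Countable := fun o g ↦ by
    have := (Omega1.countable_Iio o).to_subtype
    exact Set.countable_range _
  have wf : WellFounded ((· < ·) : Omega1 → Omega1 → Prop) :=
    InvImage.wf Subtype.val Ordinal.lt_wf
  let g : Omega1 → S := wf.fix fun o g ↦ next _ (hcount o g)
  have hg : StrictMono g := fun p o hpo ↦ by
    have key : g o = next _ (hcount o fun q _ ↦ g q) := wf.fix_eq _ o
    rw [key]
    exact hnext _ _ _ ⟨⟨p, hpo⟩, rfl⟩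
  exact ⟨OrderEmbedding.ofStrictMono (fun o ↦ (g o : R)) fun _ _ hpo ↦ hg hpo⟩

/-- If `ω₁` does not embed into `R`, a bound on the measures of the initial segments determined
by the points of `S` also bounds the measure of `S`. -/
theorem measure_preimage_le_of_forall_Iic {Ω R : Type*} [MeasurableSpace Ω] (P : Measure Ω)
    [LinearOrder R] (hR : ¬ Nonempty (Omega1 ↪o R)) (f : Ω → R) (S : Set R) (b : ENNReal)
    (hb : ∀ c ∈ S, P (f ⁻¹' Set.Iic c) ≤ b) : P (f ⁻¹' S) ≤ b := by
  obtain ⟨C, hCS, hC, hcof⟩ := exists_countable_cofinal hR S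
  have hsub : f ⁻¹' S ⊆ ⋃ c ∈ C, f ⁻¹' Set.Iic c := fun x hx ↦ by
    simpa using hcof _ hx
  refine (measure_mono hsub).trans ?_
  rw [measure_biUnion_eq_iSup hC]
  · exact iSup₂_le fun c hc ↦ hb c (hCS hc)
  · intro a ha c hc
    rcases le_total a c with h | h
    · exact ⟨c, hc, Set.preimage_mono (Set.Iic_subset_Iic.2 h), subset_rfl⟩
    · exact ⟨a, ha, subset_rfl, Set.preimage_mono (Set.Iic_subset_Iic.2 h)⟩

theorem measurableSet_singleton_of_Iic {R : Type*} [LinearOrder R] [MeasurableSpace R]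
    (hR : ¬ Nonempty (Omega1 ↪o R)) (hIic : ∀ r : R, MeasurableSet (Set.Iic r)) (r : R) :
    MeasurableSet {r} := by
  obtain ⟨C, hCS, hC, hcof⟩ := exists_countable_cofinal hR (Set.Iio r)
  have hIio : Set.Iio r = ⋃ c ∈ C, Set.Iic c := by
    ext s
    simp only [Set.mem_iUnion, Set.mem_Iic, exists_prop]
    exact ⟨hcof s, fun ⟨c, hc, hsc⟩ ↦ hsc.trans_lt (hCS hc)⟩
  rw [← Set.Iic_sdiff_Iio_same, hIio]
  exact (hIic r).diff (.biUnion hC fun c _ ↦ hIic c)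

theorem isMeasureAtom_singleton {α : Type*} [MeasurableSpace α] {P : Measure α} {a : α}
    (ha : MeasurableSet {a}) (h : P {a} ≠ 0) : IsMeasureAtom P {a} := by
  refine ⟨ha, pos_iff_ne_zero.2 h, ?_⟩
  rintro ⟨B, C, -, -, hdisj, hunion, hB, hC⟩
  have hBa : B = {a} := (Set.subset_singleton_iff_eq.1 (hunion ▸ Set.subset_union_left)).resolve_left
    (by rintro rfl; simp at hB)
  have hCa : C = {a} := (Set.subset_singleton_iff_eq.1 (hunion ▸ Set.subset_union_right)).resolve_left
    (by rintro rfl; simp at hC)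
  simp [hBa, hCa] at hdisj

theorem stmt15 {Ω : Type*} [MeasurableSpace Ω] (P : Measure Ω) [IsProbabilityMeasure P]
    (R : Type*) [LinearOrder R] [MeasurableSpace R]
    (hshort₁ : ¬ Nonempty (Omega1 ↪o R)) (hshort₂ : ¬ Nonempty (Omega1ᵒᵈ ↪o R))
    (hIic : ∀ r : R, MeasurableSet (Set.Iic r))
    (f : Ω → R) (hf : Measurable f)
    (hdiffuse : ¬ ∃ A : Set R, IsMeasureAtom (P.map f) A) :
    ∀ ε ∈ Set.Icc (0:ℝ) 1, (P {x | (P {y | f y ≤ f x}).toReal ≤ ε}).toReal = ε := by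
  rintro ε ⟨hε₀, hε₁⟩
  have hnull (r : R) : P (f ⁻¹' {r}) = 0 := by
    have hr := measurableSet_singleton_of_Iic hshort₁ hIic r
    rw [← Measure.map_apply hf hr]
    by_contra h
    exact hdiffuse ⟨_, isMeasureAtom_singleton hr h⟩
  set S : Set R := {r | P.real (f ⁻¹' Set.Iic r) ≤ ε}
  have hle : P (f ⁻¹' S) ≤ ENNReal.ofReal ε :=
    measure_preimage_le_of_forall_Iic P hshort₁ f S _ fun c hc ↦
      (ENNReal.le_ofReal_iff_toReal_le (measure_ne_top _ _) hε₀).2 hc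
  have hshort_dual : ¬ Nonempty (Omega1 ↪o Rᵒᵈ) := fun ⟨e⟩ ↦ hshort₂ ⟨e.dual⟩
  have hge : P (f ⁻¹' Sᶜ) ≤ ENNReal.ofReal (1 - ε) := by
    refine measure_preimage_le_of_forall_Iic P hshort_dual (OrderDual.toDual ∘ f)
      (OrderDual.ofDual ⁻¹' Sᶜ) _ fun c hc ↦ ?_
    have hsub : OrderDual.toDual ∘ f ⁻¹' Set.Iic c ⊆
        (f ⁻¹' Set.Iic (OrderDual.ofDual c))ᶜ ∪ f ⁻¹' {OrderDual.ofDual c} := fun x hx ↦ by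
      have hx : OrderDual.ofDual c ≤ f x := hx
      rcases hx.lt_or_eq with h | h
      · exact .inl (not_le.2 h)
      · exact .inr h.symm
    refine (measure_mono hsub).trans ((measure_union_le _ _).trans ?_)
    rw [hnull, add_zero, ENNReal.le_ofReal_iff_toReal_le (measure_ne_top _ _) (by linarith)]
    have hc : ε < P.real (f ⁻¹' Set.Iic (OrderDual.ofDual c)) := not_le.1 hc
    have := probReal_compl_eq_one_sub (μ := P) (hf (hIic (OrderDual.ofDual c)))
    change P.real _ ≤ _
    linarith
  change P.real (f ⁻¹' S) = ε
  have h₁ : P.real (f ⁻¹' S) ≤ ε := ENNReal.toReal_le_of_le_ofReal hε₀ hle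
  have h₂ : P.real (f ⁻¹' Sᶜ) ≤ 1 - ε := ENNReal.toReal_le_of_le_ofReal (by linarith) hge
  have h₃ := measureReal_union_le (μ := P) (f ⁻¹' S) (f ⁻¹' Sᶜ)
  rw [Set.preimage_compl, Set.union_compl_self, probReal_univ, ← Set.preimage_compl] at h₃
  linarith
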